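/- arXiv:2310.17697 — 8 statements merged into one kernel-verified Lean document; each statement's English description precedes it below -/
import Mathlib

section
/- Let d ≥ 3 be odd and let z : {1,…,d}×{1,…,d} → 𝔽₂ have zero syndrome for the fixed-stabilizer check system of the new XY-code state-preparation protocol. Then z is constant on the last column: z(i,d) = z(1,d) for all i=1,…,d. Consequently the restriction of the check system to the last column is exactly a length-d repetition code (Part II of Theorem 1). -/
/-- Extend a grid `z : Fin d → Fin d → ZMod 2` to all of `ℕ × ℕ` (0-based indices),
returning `0` outside the grid.  All accesses below are in range. -/
def zext {d : ℕ} (z : Fin d → Fin d → ZMod 2) (i j : ℕ) : ZMod 2 :=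
  if h : i < d ∧ j < d then z ⟨i, h.1⟩ ⟨j, h.2⟩ else 0

/-- The fixed-stabilizer check system of the new XY-code state-preparation
protocol (1-based indices of the paper shifted to 0-based): the top-boundary
checks (T), the left-boundary checks (L), the right-boundary checks (R), the
fixed four-body X-stabilizer checks (X4, faces with `r + c` even) and the fixed
four-body Y-stabilizer checks (Y4, faces with `r` even and `c` odd).  `z` has
zero syndrome if it satisfies all of these parity checks. -/
def ZeroSyndrome {d : ℕ} (z : Fin d → Fin d → ZMod 2) : Prop :=
  (∀ j, 1 ≤ j → j ≤ (d - 1) / 2 →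
    zext z 0 (2 * j - 2) + zext z 0 (2 * j - 1) = 0) ∧
  (∀ i, 1 ≤ i → i ≤ (d - 1) / 2 →
    zext z (2 * i - 1) 0 + zext z (2 * i) 0 = 0) ∧
  (∀ i, 1 ≤ i → i ≤ (d - 1) / 2 →
    zext z (2 * i - 2) (d - 1) + zext z (2 * i - 1) (d - 1) = 0) ∧
  (∀ r c, 1 ≤ r → r ≤ d - 1 → 1 ≤ c → c ≤ d - 1 → (r + c) % 2 = 0 →
    zext z (r - 1) (c - 1) + zext z (r - 1) c
      + zext z r (c - 1) + zext z r c = 0) ∧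
  (∀ r c, 1 ≤ r → r ≤ d - 1 → 1 ≤ c → c ≤ d - 1 → r % 2 = 0 → c % 2 = 1 →
    zext z (r - 1) (c - 1) + zext z (r - 1) c
      + zext z r (c - 1) + zext z r c = 0)

/-- Part II of Theorem 1: a zero-syndrome phase-error pattern is constant on
the last column, so the restriction of the check system to the last column is
exactly a length-`d` repetition code. -/
theorem lastColumn_repetition (d : ℕ) (hd : 3 ≤ d) (hodd : d % 2 = 1)
    (z : Fin d → Fin d → ZMod 2) (hz : ZeroSyndrome z) :
    ∀ i, i < d → zext z i (d - 1) = zext z 0 (d - 1) := by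
  obtain ⟨-, hL, hR, hX, hY⟩ := hz
  have e2 : ∀ a b : ZMod 2, a + b = 0 → b = a := by decide
  have e4 : ∀ a b c e : ZMod 2, a + b + c + e = 0 → a + c = 0 → b + e = 0 := by decide
  have key : ∀ i, 1 ≤ i → i ≤ (d - 1) / 2 → ∀ c, c ≤ d - 1 →
      zext z (2 * i - 1) c + zext z (2 * i) c = 0 := by
    intro i h1 h2 c
    induction c with
    | zero => intro _; exact hL i h1 h2
    | succ c ih =>
      intro hc
      have ih' := ih (by omega)
      rcases Nat.mod_two_eq_zero_or_one (c + 1) with h | h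
      · have := hX (2 * i) (c + 1) (by omega) (by omega) (by omega) hc (by omega)
        exact e4 _ _ _ _ this ih'
      · have := hY (2 * i) (c + 1) (by omega) (by omega) (by omega) hc (by omega) h
        exact e4 _ _ _ _ this ih'
  intro i
  induction i with
  | zero => intro _; rfl
  | succ n ih =>
    intro hn
    rw [← ih (by omega)]
    rcases Nat.mod_two_eq_zero_or_one n with h | h
    · have := hR (n / 2 + 1) (by omega) (by omega)
      rw [show 2 * (n / 2 + 1) - 2 = n by omega,
        show 2 * (n / 2 + 1) - 1 = n + 1 by omega] at this
      exact e2 _ _ this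
    · have := key (n / 2 + 1) (by omega) (by omega) (d - 1) le_rfl
      rw [show 2 * (n / 2 + 1) - 1 = n by omega,
        show 2 * (n / 2 + 1) = n + 1 by omega] at this
      exact e2 _ _ this
end

section
/- Let d ≥ 3 be odd and let z : {1,…,d}×{1,…,d} → 𝔽₂ have zero syndrome for the fixed-stabilizer check system of the new XY-code state-preparation protocol. Then z is constant on every fixed-Y block, i.e., z(1,2j−1)=z(1,2j) for each j=1,…,(d−1)/2, and z(2i,2j−1)=z(2i,2j)=z(2i+1,2j−1)=z(2i+1,2j) for each i,j=1,…,(d−1)/2. -/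
theorem aux_h (a b c e : ZMod 2) (h : a + b + c + e = 0) (h' : a = b) : c = e := by
  revert a b c e; decide

theorem aux_v (a b c e : ZMod 2) (h : a + b + c + e = 0) (h' : a = c) : b = e := by
  revert a b c e; decide

theorem aux_two (a b : ZMod 2) (h : a + b = 0) : a = b := by
  revert a b; decide

/-- A zero-syndrome phase-error pattern is constant on every fixed-Y block:
on each two-element top block `{(1,2j−1),(1,2j)}` and on each four-element
bulk block `{(2i,2j−1),(2i,2j),(2i+1,2j−1),(2i+1,2j)}`
(1-based indices shifted to 0-based). -/
theorem constant_on_fixedY_blocks (d : ℕ) (hd : 3 ≤ d) (hodd : d % 2 = 1)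
    (z : Fin d → Fin d → ZMod 2) (hz : ZeroSyndrome z) :
    (∀ j, 1 ≤ j → j ≤ (d - 1) / 2 →
      zext z 0 (2 * j - 2) = zext z 0 (2 * j - 1)) ∧
    (∀ i j, 1 ≤ i → i ≤ (d - 1) / 2 → 1 ≤ j → j ≤ (d - 1) / 2 →
      zext z (2 * i - 1) (2 * j - 2) = zext z (2 * i - 1) (2 * j - 1) ∧
      zext z (2 * i - 1) (2 * j - 2) = zext z (2 * i) (2 * j - 2) ∧
      zext z (2 * i - 1) (2 * j - 2) = zext z (2 * i) (2 * j - 1)) := by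
  obtain ⟨hT, hL, -, hX, hY⟩ := hz
  have A : ∀ i, 1 ≤ i → i ≤ (d - 1) / 2 → ∀ c, c < d →
      zext z (2 * i - 1) c = zext z (2 * i) c := by
    intro i h1 h2 c
    induction c with
    | zero => intro _; exact aux_two _ _ (hL i h1 h2)
    | succ c ih =>
      intro hc
      refine aux_v _ _ _ _ ?_ (ih (by omega))
      rcases Nat.mod_two_eq_zero_or_one (c + 1) with h | h
      · exact hX (2 * i) (c + 1) (by omega) (by omega) (by omega) (by omega) (by omega)
      · exact hY (2 * i) (c + 1) (by omega) (by omega) (by omega) (by omega) (by omega) h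
  have B : ∀ j, 1 ≤ j → j ≤ (d - 1) / 2 → ∀ r, r < d →
      zext z r (2 * j - 2) = zext z r (2 * j - 1) := by
    intro j h1 h2 r
    induction r with
    | zero => intro _; exact aux_two _ _ (hT j h1 h2)
    | succ r ih =>
      intro hr
      refine aux_h _ _ _ _ ?_ (ih (by omega))
      rcases Nat.mod_two_eq_zero_or_one (r + 1) with h | h
      · exact hY (r + 1) (2 * j - 1) (by omega) (by omega) (by omega) (by omega) h (by omega)
      · exact hX (r + 1) (2 * j - 1) (by omega) (by omega) (by omega) (by omega) (by omega)
  refine ⟨fun j h1 h2 => B j h1 h2 0 (by omega), fun i j h1 h2 h3 h4 => ?_⟩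
  have a := A i h1 h2 (2 * j - 2) (by omega)
  exact ⟨B j h3 h4 _ (by omega), a, a.trans (B j h3 h4 _ (by omega))⟩
end

section
/- Let d ≥ 3 be odd. A function z : {1,…,d}×{1,…,d} → 𝔽₂ has zero syndrome for the fixed-stabilizer check system of the new XY-code state-preparation protocol if and only if z is constant on every fixed-Y block and z is constant on the last column {(i,d) : i=1,…,d}. -/
theorem four_sum (a b c e : ZMod 2) : a + b + c + e = 0 ↔ (a = b ↔ c = e) := by
  revert a b c e; decide

theorem four_sum' (a b c e : ZMod 2) : a + b + c + e = 0 ↔ (a = c ↔ b = e) := by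
  revert a b c e; decide

theorem core (m : ℕ) (f : ℕ → ℕ → ZMod 2)
    (hT : ∀ j, 1 ≤ j → j ≤ m → f 0 (2 * j - 2) = f 0 (2 * j - 1))
    (hL : ∀ i, 1 ≤ i → i ≤ m → f (2 * i - 1) 0 = f (2 * i) 0)
    (hR : ∀ i, 1 ≤ i → i ≤ m → f (2 * i - 2) (2 * m) = f (2 * i - 1) (2 * m))
    (hX : ∀ r c, 1 ≤ r → r ≤ 2 * m → 1 ≤ c → c ≤ 2 * m → (r + c) % 2 = 0 →
      f (r - 1) (c - 1) + f (r - 1) c + f r (c - 1) + f r c = 0)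
    (hY : ∀ r c, 1 ≤ r → r ≤ 2 * m → 1 ≤ c → c ≤ 2 * m → r % 2 = 0 → c % 2 = 1 →
      f (r - 1) (c - 1) + f (r - 1) c + f r (c - 1) + f r c = 0) :
    (∀ i j, 1 ≤ i → i ≤ m → 1 ≤ j → j ≤ m →
          f (2 * i - 1) (2 * j - 2) = f (2 * i - 1) (2 * j - 1) ∧
          f (2 * i - 1) (2 * j - 2) = f (2 * i) (2 * j - 2) ∧
          f (2 * i - 1) (2 * j - 2) = f (2 * i) (2 * j - 1)) ∧
       (∀ i, i < 2 * m + 1 → f i (2 * m) = f 0 (2 * m)) := by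
  have A : ∀ i, 1 ≤ i → i ≤ m → ∀ c, c ≤ 2 * m → f (2 * i - 1) c = f (2 * i) c := by
    intro i h1 h2 c
    induction c with
    | zero => intro _; exact hL i h1 h2
    | succ c ih =>
      intro hc
      have h : f (2 * i - 1) (c + 1 - 1) + f (2 * i - 1) (c + 1)
          + f (2 * i) (c + 1 - 1) + f (2 * i) (c + 1) = 0 := by
        rcases Nat.mod_two_eq_zero_or_one (c + 1) with h | h
        · exact hX (2 * i) (c + 1) (by omega) (by omega) (by omega) hc (by omega)
        · exact hY (2 * i) (c + 1) (by omega) (by omega) (by omega) hc (by omega) h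
      exact ((four_sum' _ _ _ _).1 h).1 (ih (by omega))
  have B : ∀ j, 1 ≤ j → j ≤ m → ∀ r, r ≤ 2 * m → f r (2 * j - 2) = f r (2 * j - 1) := by
    intro j h1 h2 r
    induction r with
    | zero => intro _; exact hT j h1 h2
    | succ r ih =>
      intro hr
      have h : f (r + 1 - 1) (2 * j - 1 - 1) + f (r + 1 - 1) (2 * j - 1)
          + f (r + 1) (2 * j - 1 - 1) + f (r + 1) (2 * j - 1) = 0 := by
        rcases Nat.mod_two_eq_zero_or_one (r + 1) with h | h
        · exact hY (r + 1) (2 * j - 1) (by omega) (by omega) (by omega) (by omega) h (by omega)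
        · exact hX (r + 1) (2 * j - 1) (by omega) (by omega) (by omega) (by omega) (by omega)
      exact ((four_sum _ _ _ _).1 h).1 (ih (by omega))
  refine ⟨fun i j h1 h2 h3 h4 => ⟨B j h3 h4 _ (by omega), A i h1 h2 _ (by omega),
    (A i h1 h2 _ (by omega)).trans (B j h3 h4 _ (by omega))⟩, ?_⟩
  intro i
  induction i with
  | zero => intro _; rfl
  | succ r ih =>
    intro hr
    rw [← ih (by omega)]
    rcases Nat.even_or_odd' r with ⟨k, rfl | rfl⟩
    · exact (hR (k + 1) (by omega) (by omega)).symm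
    · exact (A (k + 1) (by omega) (by omega) (2 * m) le_rfl).symm

theorem core' (m : ℕ) (f : ℕ → ℕ → ZMod 2)
    (hT : ∀ j, 1 ≤ j → j ≤ m → f 0 (2 * j - 2) = f 0 (2 * j - 1))
    (hB : ∀ i j, 1 ≤ i → i ≤ m → 1 ≤ j → j ≤ m →
          f (2 * i - 1) (2 * j - 2) = f (2 * i - 1) (2 * j - 1) ∧
          f (2 * i - 1) (2 * j - 2) = f (2 * i) (2 * j - 2) ∧
          f (2 * i - 1) (2 * j - 2) = f (2 * i) (2 * j - 1))
    (hC : ∀ i, i < 2 * m + 1 → f i (2 * m) = f 0 (2 * m)) :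
    (∀ i, 1 ≤ i → i ≤ m → ∀ c, c ≤ 2 * m → f (2 * i - 1) c = f (2 * i) c) ∧
    (∀ j, 1 ≤ j → j ≤ m → ∀ r, r ≤ 2 * m → f r (2 * j - 2) = f r (2 * j - 1)) := by
  constructor
  · intro i h1 h2 c hc
    rcases Nat.even_or_odd' c with ⟨k, rfl | rfl⟩
    · by_cases hk : k = m
      · subst hk
        rw [hC _ (by omega), hC (2 * i) (by omega)]
      · exact (hB i (k + 1) h1 h2 (by omega) (by omega)).2.1
    · have := hB i (k + 1) h1 h2 (by omega) (by omega)
      exact this.1.symm.trans this.2.2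
  · intro j h1 h2 r hr
    rcases Nat.even_or_odd' r with ⟨k, rfl | rfl⟩
    · by_cases hk : k = 0
      · subst hk; exact hT j h1 h2
      · have := hB k j (by omega) (by omega) h1 h2
        exact this.2.1.symm.trans this.2.2
    · exact (hB (k + 1) j (by omega) (by omega) h1 h2).1

/-- A phase-error pattern has zero syndrome for the fixed-stabilizer check
system if and only if it is constant on every fixed-Y block and constant on
the last column. -/
theorem zeroSyndrome_iff_block_and_lastColumn_constant
    (d : ℕ) (hd : 3 ≤ d) (hodd : d % 2 = 1)
    (z : Fin d → Fin d → ZMod 2) :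
    ZeroSyndrome z ↔
      ((∀ j, 1 ≤ j → j ≤ (d - 1) / 2 →
          zext z 0 (2 * j - 2) = zext z 0 (2 * j - 1)) ∧
       (∀ i j, 1 ≤ i → i ≤ (d - 1) / 2 → 1 ≤ j → j ≤ (d - 1) / 2 →
          zext z (2 * i - 1) (2 * j - 2) = zext z (2 * i - 1) (2 * j - 1) ∧
          zext z (2 * i - 1) (2 * j - 2) = zext z (2 * i) (2 * j - 2) ∧
          zext z (2 * i - 1) (2 * j - 2) = zext z (2 * i) (2 * j - 1)) ∧
       (∀ i, i < d → zext z i (d - 1) = zext z 0 (d - 1))) := by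
  obtain ⟨m, rfl⟩ : ∃ m, d = 2 * m + 1 := ⟨d / 2, by omega⟩
  have e1 : (2 * m + 1 - 1) / 2 = m := by omega
  have e2 : 2 * m + 1 - 1 = 2 * m := by omega
  unfold ZeroSyndrome
  rw [e1, e2]
  generalize zext z = f
  simp only [CharTwo.add_eq_zero (R := ZMod 2) (a := f 0 _),
    CharTwo.add_eq_zero (a := f _ 0), CharTwo.add_eq_zero (a := f _ (2 * m))]
  constructor
  · rintro ⟨hT, hL, hR, hX, hY⟩
    exact ⟨hT, core m f hT hL hR hX hY⟩
  · rintro ⟨hT, hB, hC⟩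
    obtain ⟨A, B⟩ := core' m f hT hB hC
    have E : ∀ r c, 1 ≤ r → r ≤ 2 * m → 1 ≤ c → c ≤ 2 * m → (r % 2 = 0 ∨ c % 2 = 1) →
        f (r - 1) (c - 1) + f (r - 1) c + f r (c - 1) + f r c = 0 := by
      intro r c h1 h2 h3 h4 h
      rcases h with h | h
      · obtain ⟨k, rfl⟩ : ∃ k, r = 2 * k := ⟨r / 2, by omega⟩
        rw [A k (by omega) (by omega) _ (by omega), A k (by omega) (by omega) _ h4, four_sum]
      · obtain ⟨k, rfl⟩ : ∃ k, c = 2 * (k + 1) - 1 := ⟨c / 2, by omega⟩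
        have := B (k + 1) (by omega) (by omega)
        rw [four_sum]
        exact ⟨fun _ => this _ h2, fun _ => this _ (by omega)⟩
    refine ⟨hT, fun i h1 h2 => A i h1 h2 0 (by omega), fun i h1 h2 => ?_,
      fun r c h1 h2 h3 h4 h => E r c h1 h2 h3 h4 (by omega),
      fun r c h1 h2 h3 h4 h _ => E r c h1 h2 h3 h4 (by omega)⟩
    rw [hC _ (by omega), hC (2 * i - 1) (by omega)]
end

section
/- Let d ≥ 3 be odd. The set of functions z : {1,…,d}×{1,…,d} → 𝔽₂ with zero syndrome for the fixed-stabilizer check system of the new XY-code state-preparation protocol has cardinality exactly 2^((d−1)/2 + (d−1)²/4 + 1). -/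
theorem aux4 : ∀ a b c d : ZMod 2, a + b + c + d = 0 → a = b → d = c := by decide
theorem aux4' : ∀ a b c d : ZMod 2, a + b + c + d = 0 → a = c → b = d := by decide
theorem aux2 : ∀ a b : ZMod 2, a + b = 0 → a = b := by decide
theorem aux2r : ∀ a b : ZMod 2, a = b → a + b = 0 := by decide
theorem aux4r : ∀ a b c d : ZMod 2, a = b → c = d → a + b + c + d = 0 := by decide
theorem aux4r' : ∀ a b c d : ZMod 2, a = c → b = d → a + b + c + d = 0 := by decide

theorem zs_col {m : ℕ} (z : Fin (2*m+1) → Fin (2*m+1) → ZMod 2) (h : ZeroSyndrome z)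
    (j : ℕ) (hj : j < m) : ∀ i, i ≤ 2*m → zext z i (2*j+1) = zext z i (2*j) := by
  obtain ⟨hT, hL, hR, hX, hY⟩ := h
  intro i
  induction i with
  | zero =>
    intro _
    have := hT (j+1) (by omega) (by omega)
    rw [show 2*(j+1)-2 = 2*j by omega, show 2*(j+1)-1 = 2*j+1 by omega] at this
    exact (aux2 _ _ this).symm
  | succ i ih =>
    intro hi
    have ih := ih (by omega)
    have key : zext z i (2*j) + zext z i (2*j+1) + zext z (i+1) (2*j)
        + zext z (i+1) (2*j+1) = 0 := by
      rcases Nat.mod_two_eq_zero_or_one i with h0 | h0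
      · exact hX (i+1) (2*j+1) (by omega) (by omega) (by omega) (by omega) (by omega)
      · exact hY (i+1) (2*j+1) (by omega) (by omega) (by omega) (by omega) (by omega) (by omega)
    exact aux4 _ _ _ _ key ih.symm

theorem zs_row {m : ℕ} (z : Fin (2*m+1) → Fin (2*m+1) → ZMod 2) (h : ZeroSyndrome z)
    (i : ℕ) (hi : i < m) : ∀ j, j ≤ m → zext z (2*i+1) (2*j) = zext z (2*i+2) (2*j) := by
  have hc := zs_col z h
  obtain ⟨hT, hL, hR, hX, hY⟩ := h
  intro j
  induction j with
  | zero =>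
    intro _
    have := hL (i+1) (by omega) (by omega)
    exact aux2 _ _ this
  | succ j ih =>
    intro hj
    have ih := ih (by omega)
    have key := hX (2*i+2) (2*j+2) (by omega) (by omega) (by omega) (by omega) (by omega)
    rw [show 2*i+2-1 = 2*i+1 by omega, show 2*j+2-1 = 2*j+1 by omega] at key
    refine aux4' _ _ _ _ key ?_
    rw [hc j (by omega) _ (by omega), hc j (by omega) _ (by omega), ih]

theorem zs_last {m : ℕ} (z : Fin (2*m+1) → Fin (2*m+1) → ZMod 2) (h : ZeroSyndrome z) :
    ∀ i, i ≤ 2*m → zext z i (2*m) = zext z 0 (2*m) := by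
  have hr := zs_row z h
  obtain ⟨hT, hL, hR, hX, hY⟩ := h
  intro i
  induction i with
  | zero => intro _; rfl
  | succ i ih =>
    intro hi
    rw [← ih (by omega)]
    rcases Nat.even_or_odd' i with ⟨k, rfl | rfl⟩
    · have := hR (k+1) (by omega) (by omega)
      rw [show 2*(k+1)-2 = 2*k by omega, show 2*(k+1)-1 = 2*k+1 by omega,
        show 2*m+1-1 = 2*m by omega] at this
      exact (aux2 _ _ this).symm
    · exact (hr k (by omega) m le_rfl).symm

/-- The pattern built from free data. -/
def zsBuild (m : ℕ) (p : (Fin (m+1) → Fin m → ZMod 2) × ZMod 2) :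
    Fin (2*m+1) → Fin (2*m+1) → ZMod 2 := fun i j =>
  if h : j.val = 2*m then p.2
  else p.1 ⟨(i.val+1)/2, by omega⟩ ⟨j.val/2, by omega⟩

theorem zsBuild_last (m : ℕ) (p) (i : ℕ) (hi : i ≤ 2*m) :
    zext (zsBuild m p) i (2*m) = p.2 := by
  unfold zext zsBuild
  rw [dif_pos ⟨by omega, by omega⟩]
  simp

theorem zsBuild_in (m : ℕ) (p) (i j a b : ℕ) (hi : i ≤ 2*m) (hj : j < 2*m)
    (ha : a < m+1) (hb : b < m) (hia : (i+1)/2 = a) (hjb : j/2 = b) :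
    zext (zsBuild m p) i j = p.1 ⟨a, ha⟩ ⟨b, hb⟩ := by
  subst hia hjb
  unfold zext zsBuild
  rw [dif_pos ⟨by omega, by omega⟩, dif_neg (by simp; omega)]

theorem zsBuild_congr (m : ℕ) (p) (i j a b : ℕ) (hi : i ≤ 2*m) (hj : j ≤ 2*m)
    (ha : a ≤ 2*m) (hb : b ≤ 2*m)
    (h : (j = 2*m ∧ b = 2*m) ∨ (j < 2*m ∧ b < 2*m ∧ (i+1)/2 = (a+1)/2 ∧ j/2 = b/2)) :
    zext (zsBuild m p) i j = zext (zsBuild m p) a b := by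
  rcases h with ⟨rfl, rfl⟩ | ⟨h1, h2, h3, h4⟩
  · rw [zsBuild_last _ _ _ hi, zsBuild_last _ _ _ ha]
  · rw [zsBuild_in m p i j ((a+1)/2) (b/2) hi h1 (by omega) (by omega) h3 h4,
      zsBuild_in m p a b ((a+1)/2) (b/2) ha h2 (by omega) (by omega) rfl rfl]

theorem zsBuild_zs (m : ℕ) (p) : ZeroSyndrome (zsBuild m p) := by
  refine ⟨?_, ?_, ?_, ?_, ?_⟩
  · intro j h1 h2
    apply aux2r
    apply zsBuild_congr <;> omega
  · intro j h1 h2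
    apply aux2r
    apply zsBuild_congr <;> omega
  · intro j h1 h2
    apply aux2r
    apply zsBuild_congr <;> omega
  · intro r c h1 h2 h3 h4 h5
    rcases Nat.mod_two_eq_zero_or_one r with h0 | h0
    · apply aux4r' <;> apply zsBuild_congr <;> omega
    · apply aux4r <;> apply zsBuild_congr <;> omega
  · intro r c h1 h2 h3 h4 h5 h6
    apply aux4r <;> apply zsBuild_congr <;> omega

/-- Zero-syndrome patterns correspond to free data. -/
def zsEquiv (m : ℕ) : {z : Fin (2*m+1) → Fin (2*m+1) → ZMod 2 // ZeroSyndrome z} ≃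
    (Fin (m+1) → Fin m → ZMod 2) × ZMod 2 where
  toFun z := (fun p q => zext z.1 (2*p.val) (2*q.val), zext z.1 0 (2*m))
  invFun p := ⟨zsBuild m p, zsBuild_zs m p⟩
  left_inv := by
    rintro ⟨z, hz⟩
    apply Subtype.ext
    funext ⟨i, hi⟩ ⟨j, hj⟩
    have e : z ⟨i, hi⟩ ⟨j, hj⟩ = zext z i j := by
      unfold zext; rw [dif_pos ⟨hi, hj⟩]
    refine Eq.trans ?_ e.symm
    dsimp only
    unfold zsBuild
    by_cases h : j = 2*m
    · subst h
      simp [zs_last z hz i (by omega)]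
    · rw [dif_neg h]
      have e1 : zext z i j = zext z i (2*(j/2)) := by
        rcases Nat.even_or_odd' j with ⟨k, rfl | rfl⟩
        · congr 1; omega
        · rw [zs_col z hz k (by omega) i (by omega)]; congr 1; omega
      rw [e1]
      change zext z (2*((i+1)/2)) (2*(j/2)) = _
      rcases Nat.even_or_odd' i with ⟨k, rfl | rfl⟩
      · congr 1; omega
      · rw [zs_row z hz k (by omega) (j/2) (by omega)]; congr 1; omega
  right_inv := by
    intro p
    apply Prod.ext
    · funext a b
      exact zsBuild_in m p _ _ _ _ (by omega) (by omega) a.2 b.2 (by omega) (by omega)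
    · exact zsBuild_last m p 0 (by omega)

/-- The number of phase-error patterns with zero syndrome for the
fixed-stabilizer check system of the new XY-code state-preparation protocol
is exactly `2 ^ ((d−1)/2 + (d−1)²/4 + 1)`. -/
theorem card_zeroSyndrome (d : ℕ) (hd : 3 ≤ d) (hodd : d % 2 = 1) :
    Nat.card {z : Fin d → Fin d → ZMod 2 // ZeroSyndrome z}
      = 2 ^ ((d - 1) / 2 + (d - 1) ^ 2 / 4 + 1) := by
  obtain ⟨m, rfl⟩ : ∃ m, d = 2*m+1 := ⟨d/2, by omega⟩
  rw [Nat.card_congr (zsEquiv m), Nat.card_eq_fintype_card]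
  have h1 : (2*m+1-1)/2 = m := by omega
  have h2 : (2*m+1-1)^2/4 = m^2 := by
    rw [show (2*m+1-1)^2 = m^2*4 by rw [Nat.add_sub_cancel]; ring]
    exact Nat.mul_div_cancel _ (by norm_num)
  rw [h1, h2]
  simp only [Fintype.card_prod, Fintype.card_pi, ZMod.card, Finset.prod_const,
    Finset.card_univ, Fintype.card_fin]
  rw [← pow_mul, ← pow_succ]
  congr 1
  ring
end

section
/- Let d ≥ 3 be odd and let z : {1,…,d}×{1,…,d} → 𝔽₂. Then z has zero syndrome for the fixed-stabilizer check system of the new XY-code state-preparation protocol and vanishes on the last column (z(i,d)=0 for all i) if and only if z lies in the 𝔽₂-linear span of the indicator functions of the fixed-Y blocks. (This is Part I of Theorem 1: such z correspond to products of Z⊗2 and Z⊗4 operators that act trivially on the GHZ-initialized state, so Z errors on all bulk qubits are correctable.) -/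
/-- Indicator function of the two-element fixed-Y block
`{(1,2j−1),(1,2j)}` (1-based, shifted to 0-based). -/
def topInd (d j : ℕ) : Fin d → Fin d → ZMod 2 := fun r c =>
  if r.val = 0 ∧ (c.val = 2 * j - 2 ∨ c.val = 2 * j - 1) then 1 else 0

/-- Indicator function of the four-element fixed-Y block
`{(2i,2j−1),(2i,2j),(2i+1,2j−1),(2i+1,2j)}` (1-based, shifted to 0-based). -/
def bulkInd (d i j : ℕ) : Fin d → Fin d → ZMod 2 := fun r c =>
  if (r.val = 2 * i - 1 ∨ r.val = 2 * i) ∧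
      (c.val = 2 * j - 2 ∨ c.val = 2 * j - 1) then 1 else 0

/-- The set of indicator functions of all fixed-Y blocks. -/
def blockIndicators (d : ℕ) : Set (Fin d → Fin d → ZMod 2) :=
  {f | (∃ j, 1 ≤ j ∧ j ≤ (d - 1) / 2 ∧ f = topInd d j) ∨
       (∃ i j, 1 ≤ i ∧ i ≤ (d - 1) / 2 ∧ 1 ≤ j ∧ j ≤ (d - 1) / 2 ∧
          f = bulkInd d i j)}

def PP {d : ℕ} (z : Fin d → Fin d → ZMod 2) : Prop :=
  (∀ r c, r < d → 2 * c + 1 < d → zext z r (2 * c) = zext z r (2 * c + 1)) ∧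
  (∀ r c, 2 * r + 2 < d → c < d → zext z (2 * r + 1) c = zext z (2 * r + 2) c) ∧
  (∀ r, r < d → zext z r (d - 1) = 0)

theorem zext_add' {d : ℕ} (x y : Fin d → Fin d → ZMod 2) (i j : ℕ) :
    zext (x + y) i j = zext x i j + zext y i j := by
  unfold zext; split_ifs <;> simp

theorem zext_smul' {d : ℕ} (a : ZMod 2) (x : Fin d → Fin d → ZMod 2) (i j : ℕ) :
    zext (a • x) i j = a * zext x i j := by
  unfold zext; split_ifs <;> simp

theorem zext_zero' {d : ℕ} (i j : ℕ) :
    zext (0 : Fin d → Fin d → ZMod 2) i j = 0 := by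
  unfold zext; split_ifs <;> simp

theorem z2_eq {a b : ZMod 2} : a + b = 0 ↔ a = b := by
  revert a b; decide

def BB (d i j : ℕ) : Fin d → Fin d → ZMod 2 := fun r c =>
  if i = (r.val + 1) / 2 then (if j = c.val / 2 then 1 else 0) else 0

theorem topInd_eq (d j : ℕ) (hj : 1 ≤ j) : topInd d j = BB d 0 (j - 1) := by
  funext r c
  unfold topInd BB
  rw [← ite_and]
  congr 1
  apply propext
  omega

theorem bulkInd_eq (d i j : ℕ) (hi : 1 ≤ i) (hj : 1 ≤ j) :
    bulkInd d i j = BB d i (j - 1) := by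
  funext r c
  unfold bulkInd BB
  rw [← ite_and]
  congr 1
  apply propext
  omega

theorem BB_PP (d i j : ℕ) (hodd : d % 2 = 1) (hj : j < (d - 1) / 2) : PP (BB d i j) := by
  refine ⟨fun r c hr hc => ?_, fun r c hr hc => ?_, fun r hr => ?_⟩
  · have h1 : 2 * c < d := by omega
    have h2 : (2 * c + 1) / 2 = c := by omega
    simp [zext, BB, hr, hc, h1, h2]
  · have h1 : 2 * r + 1 < d := by omega
    have h2 : (2 * r + 1 + 1) / 2 = r + 1 := by omega
    have h3 : (2 * r + 2 + 1) / 2 = r + 1 := by omega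
    simp [zext, BB, hr, hc, h1, h2, h3]
  · have h1 : d - 1 < d := by omega
    have h2 : j ≠ (d - 1) / 2 := by omega
    simp [zext, BB, hr, h1, h2]

theorem span_PP (d : ℕ) (hodd : d % 2 = 1) (z : Fin d → Fin d → ZMod 2)
    (hz : z ∈ Submodule.span (ZMod 2) (blockIndicators d)) : PP z := by
  induction hz using Submodule.span_induction with
  | mem x hx =>
    rcases hx with ⟨j, h1, h2, rfl⟩ | ⟨i, j, h1, h2, h3, h4, rfl⟩
    · rw [topInd_eq _ _ h1]; exact BB_PP _ _ _ hodd (by omega)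
    · rw [bulkInd_eq _ _ _ h1 h3]; exact BB_PP _ _ _ hodd (by omega)
  | zero => simp [PP, zext_zero']
  | add x y _ _ hx hy =>
    refine ⟨fun r c hr hc => ?_, fun r c hr hc => ?_, fun r hr => ?_⟩
    · rw [zext_add', zext_add', hx.1 r c hr hc, hy.1 r c hr hc]
    · rw [zext_add', zext_add', hx.2.1 r c hr hc, hy.2.1 r c hr hc]
    · rw [zext_add', hx.2.2 r hr, hy.2.2 r hr, add_zero]
  | smul a x _ hx =>
    refine ⟨fun r c hr hc => ?_, fun r c hr hc => ?_, fun r hr => ?_⟩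
    · rw [zext_smul', zext_smul', hx.1 r c hr hc]
    · rw [zext_smul', zext_smul', hx.2.1 r c hr hc]
    · rw [zext_smul', hx.2.2 r hr, mul_zero]

theorem PP_span (d : ℕ) (hodd : d % 2 = 1) (z : Fin d → Fin d → ZMod 2)
    (hz : PP z) : z ∈ Submodule.span (ZMod 2) (blockIndicators d) := by
  have key : z = ∑ i ∈ Finset.range ((d - 1) / 2 + 1), ∑ j ∈ Finset.range ((d - 1) / 2),
      zext z (2 * i - 1) (2 * j) • BB d i j := by
    funext r c
    have hr := r.2
    have hc := c.2
    have h0 : z r c = zext z r c := by simp [zext]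
    have h1 : (r.val + 1) / 2 < (d - 1) / 2 + 1 := by omega
    simp only [Finset.sum_apply, Pi.smul_apply, BB, smul_eq_mul, mul_ite, mul_one, mul_zero]
    have h3 : ∀ i ∈ Finset.range ((d - 1) / 2 + 1), (∑ j ∈ Finset.range ((d - 1) / 2),
        (if i = (r.val + 1) / 2 then
          (if j = c.val / 2 then zext z (2 * i - 1) (2 * j) else 0) else 0)) =
        if i = (r.val + 1) / 2 then
          (if c.val / 2 < (d - 1) / 2 then zext z (2 * i - 1) (2 * (c.val / 2)) else 0)
          else 0 := by
      intro i _
      by_cases ha : i = (r.val + 1) / 2 <;> simp [ha, Finset.sum_ite_eq']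
    rw [Finset.sum_congr rfl h3, Finset.sum_ite_eq', if_pos (Finset.mem_range.2 h1), h0]
    split_ifs with hb
    · have e1 : zext z r c = zext z r (2 * (c.val / 2)) := by
        rcases Nat.mod_two_eq_zero_or_one c.val with h | h
        · congr 1; omega
        · rw [hz.1 r _ hr (by omega)]; congr 1; omega
      rw [e1]
      rcases Nat.eq_zero_or_pos r.val with h | h
      · rw [h]
      · rcases Nat.mod_two_eq_zero_or_one r.val with h' | h'
        · have := hz.2.1 (r.val / 2 - 1) (2 * (c.val / 2)) (by omega) (by omega)
          rw [show 2 * (r.val / 2 - 1) + 2 = r.val by omega] at this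
          rw [← this]; congr 1; omega
        · congr 1; omega
    · rw [show c.val = d - 1 by omega]
      exact hz.2.2 r hr
  rw [key]
  refine Submodule.sum_mem _ fun i hi => Submodule.sum_mem _ fun j hj =>
    Submodule.smul_mem _ _ (Submodule.subset_span ?_)
  rw [Finset.mem_range] at hi hj
  rcases Nat.eq_zero_or_pos i with h | h
  · left
    refine ⟨j + 1, by omega, by omega, ?_⟩
    rw [topInd_eq _ _ (by omega), h]; rfl
  · right
    refine ⟨i, j + 1, by omega, by omega, by omega, by omega, ?_⟩
    rw [bulkInd_eq _ _ _ h (by omega)]; rfl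

theorem PP_syn (d : ℕ) (hodd : d % 2 = 1) (z : Fin d → Fin d → ZMod 2)
    (hz : PP z) : ZeroSyndrome z := by
  obtain ⟨h1, h2, h3⟩ := hz
  have hz2 : ∀ a : ZMod 2, a + a = 0 := by decide
  have hz4 : ∀ a b : ZMod 2, a + a + b + b = 0 := by decide
  have hz5 : ∀ a b : ZMod 2, a + b + a + b = 0 := by decide
  have hcol : ∀ r c, 1 ≤ r → r ≤ d - 1 → 1 ≤ c → c ≤ d - 1 → c % 2 = 1 →
      zext z (r - 1) (c - 1) + zext z (r - 1) c
      + zext z r (c - 1) + zext z r c = 0 := by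
    intro r c _ _ _ _ hc
    obtain ⟨k, rfl⟩ : ∃ k, c = 2 * k + 1 := ⟨c / 2, by omega⟩
    rw [Nat.add_sub_cancel, h1 (r - 1) k (by omega) (by omega), h1 r k (by omega) (by omega)]
    exact hz4 _ _
  refine ⟨fun j hj hj' => ?_, fun i hi hi' => ?_, fun i hi hi' => ?_,
    fun r c a1 a2 a3 a4 a5 => ?_, fun r c a1 a2 a3 a4 a5 a6 => hcol r c a1 a2 a3 a4 a6⟩
  · obtain ⟨k, rfl⟩ : ∃ k, j = k + 1 := ⟨j - 1, by omega⟩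
    have := h1 0 k (by omega) (by omega)
    rw [show 2 * (k + 1) - 2 = 2 * k by omega, show 2 * (k + 1) - 1 = 2 * k + 1 by omega, this]
    exact hz2 _
  · obtain ⟨k, rfl⟩ : ∃ k, i = k + 1 := ⟨i - 1, by omega⟩
    have := h2 k 0 (by omega) (by omega)
    rw [show 2 * (k + 1) = 2 * k + 2 by omega, show 2 * k + 2 - 1 = 2 * k + 1 by omega, this]
    exact hz2 _
  · rw [h3 _ (by omega), h3 _ (by omega), add_zero]
  · rcases Nat.mod_two_eq_zero_or_one c with h | h
    · obtain ⟨k, rfl⟩ : ∃ k, r = 2 * k + 2 := ⟨r / 2 - 1, by omega⟩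
      rw [show 2 * k + 2 - 1 = 2 * k + 1 by omega, h2 k _ (by omega) (by omega),
        h2 k _ (by omega) (by omega)]
      exact hz5 _ _
    · exact hcol r c a1 a2 a3 a4 h

theorem syn_PP (d : ℕ) (hodd : d % 2 = 1) (z : Fin d → Fin d → ZMod 2)
    (hz : ZeroSyndrome z) (h0 : ∀ i, i < d → zext z i (d - 1) = 0) : PP z := by
  obtain ⟨hT, hL, -, hX, hY⟩ := hz
  have f1 : ∀ a b e : ZMod 2, a + a + b + e = 0 → b = e := by decide
  have f2 : ∀ a b e : ZMod 2, a + b + a + e = 0 → b = e := by decide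
  have hA : ∀ r c, r < d → 2 * c + 1 < d → zext z r (2 * c) = zext z r (2 * c + 1) := by
    intro r c hr hc
    induction r with
    | zero => exact z2_eq.1 (hT (c + 1) (by omega) (by omega))
    | succ r ih =>
      have := ih (by omega)
      have h : zext z r (2 * c) + zext z r (2 * c + 1) + zext z (r + 1) (2 * c)
          + zext z (r + 1) (2 * c + 1) = 0 := by
        rcases Nat.mod_two_eq_zero_or_one (r + 1) with h | h
        · exact hY (r + 1) (2 * c + 1) (by omega) (by omega) (by omega) (by omega) h (by omega)
        · exact hX (r + 1) (2 * c + 1) (by omega) (by omega) (by omega) (by omega) (by omega)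
      rw [this] at h
      exact f1 _ _ _ h
  refine ⟨hA, fun r c hr hc => ?_, h0⟩
  induction c with
  | zero => exact z2_eq.1 (hL (r + 1) (by omega) (by omega))
  | succ c ih =>
    have ih := ih (by omega)
    rcases Nat.mod_two_eq_zero_or_one c with h | h
    · obtain ⟨k, rfl⟩ : ∃ k, c = 2 * k := ⟨c / 2, by omega⟩
      rw [← hA _ _ (by omega) hc, ← hA _ _ (by omega) hc, ih]
    · have h := hX (2 * r + 2) (c + 1) (by omega) (by omega) (by omega) (by omega) (by omega)
      rw [show 2 * r + 2 - 1 = 2 * r + 1 by omega, Nat.add_sub_cancel, ih] at h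
      exact f2 _ _ _ h

/-- Part I of Theorem 1: a phase-error pattern has zero syndrome and vanishes
on the last column if and only if it lies in the `𝔽₂`-linear span of the
indicator functions of the fixed-Y blocks. -/
theorem zeroSyndrome_vanishing_lastColumn_iff_mem_span
    (d : ℕ) (hd : 3 ≤ d) (hodd : d % 2 = 1)
    (z : Fin d → Fin d → ZMod 2) :
    (ZeroSyndrome z ∧ ∀ i, i < d → zext z i (d - 1) = 0) ↔
      z ∈ Submodule.span (ZMod 2) (blockIndicators d) := by
  constructor
  · rintro ⟨h1, h2⟩
    exact PP_span d hodd z (syn_PP d hodd z h1 h2)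
  · intro h
    have := span_PP d hodd z h
    exact ⟨PP_syn d hodd z this, this.2.2⟩
end

section
/- Let d ≥ 3 be odd. (a) Every z : {1,…,d}×{1,…,d} → 𝔽₂ with zero syndrome for the fixed-stabilizer check system of the new XY-code state-preparation protocol that is nonzero at some site of the last column has Hamming weight at least d; (b) the indicator function of the last column {(i,d) : i=1,…,d} has zero syndrome, has Hamming weight exactly d, and does not lie in the 𝔽₂-linear span of the indicator functions of the fixed-Y blocks. Hence the effective distance of the protocol to pure Z errors is exactly d = √n, where n = d² is the number of qubits. -/
/-- Hamming weight of a phase-error pattern: the number of sites where it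
equals `1`. -/
def wt {d : ℕ} (z : Fin d → Fin d → ZMod 2) : ℕ :=
  (Finset.univ.filter fun p : Fin d × Fin d => z p.1 p.2 = 1).card

/-- Indicator function of the last column `{(i,d) : i = 1,…,d}`. -/
def lastColInd (d : ℕ) : Fin d → Fin d → ZMod 2 := fun _ c =>
  if c.val = d - 1 then 1 else 0

theorem aux_row {d : ℕ} (hodd : d % 2 = 1) (z : Fin d → Fin d → ZMod 2)
    (h : ZeroSyndrome z) (i : ℕ) (h1 : 1 ≤ i) (h2 : i ≤ (d - 1) / 2) (c : ℕ) (hc : c ≤ d - 1) :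
    zext z (2 * i - 1) c + zext z (2 * i) c = 0 := by
  obtain ⟨_, hL, _, hX, hY⟩ := h
  induction c with
  | zero => exact hL i h1 h2
  | succ c ih =>
    have ih := ih (by omega)
    have key : zext z (2 * i - 1) c + zext z (2 * i - 1) (c + 1)
        + zext z (2 * i) c + zext z (2 * i) (c + 1) = 0 := by
      rcases Nat.mod_two_eq_zero_or_one (c + 1) with hm | hm
      · exact hX (2 * i) (c + 1) (by omega) (by omega) (by omega) hc (by omega)
      · exact hY (2 * i) (c + 1) (by omega) (by omega) (by omega) hc (by omega) hm
    linear_combination key - ih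

theorem aux_z2 {a b : ZMod 2} (h : a + b = 0) : a = b := by
  revert a b; decide

theorem aux_col {d : ℕ} (hodd : d % 2 = 1) (z : Fin d → Fin d → ZMod 2)
    (h : ZeroSyndrome z) (i : ℕ) (hi : i < d) :
    zext z i (d - 1) = zext z 0 (d - 1) := by
  induction i with
  | zero => rfl
  | succ i ih =>
    rw [← ih (by omega)]
    symm
    apply aux_z2
    rcases Nat.mod_two_eq_zero_or_one i with hm | hm
    · have := h.2.2.1 (i / 2 + 1) (by omega) (by omega)
      rwa [show 2 * (i / 2 + 1) - 2 = i by omega,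
        show 2 * (i / 2 + 1) - 1 = i + 1 by omega] at this
    · have := aux_row hodd z h (i / 2 + 1) (by omega) (by omega) (d - 1) le_rfl
      rwa [show 2 * (i / 2 + 1) - 1 = i by omega,
        show 2 * (i / 2 + 1) = i + 1 by omega] at this

theorem aux_zext (d i j : ℕ) (hi : i < d) (hj : j < d) :
    zext (lastColInd d) i j = if j = d - 1 then 1 else 0 := by
  simp [zext, lastColInd, hi, hj]

/-- (a) Every zero-syndrome pattern that is nonzero somewhere on the last
column has Hamming weight at least `d`; (b) the indicator of the last column
has zero syndrome, Hamming weight exactly `d`, and does not lie in the span of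
the fixed-Y block indicators.  Hence the effective distance of the protocol to
pure `Z` errors is exactly `d = √n`. -/
theorem effective_distance (d : ℕ) (hd : 3 ≤ d) (hodd : d % 2 = 1) :
    (∀ z : Fin d → Fin d → ZMod 2, ZeroSyndrome z →
        (∃ i, i < d ∧ zext z i (d - 1) ≠ 0) → d ≤ wt z) ∧
    ZeroSyndrome (lastColInd d) ∧
    wt (lastColInd d) = d ∧
    lastColInd d ∉ Submodule.span (ZMod 2) (blockIndicators d) := by
  have hlast : d - 1 < d := by omega
  have h2 : (1 : ZMod 2) + 1 = 0 := by decide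
  refine ⟨?_, ?_, ?_, ?_⟩
  · rintro z hz ⟨i, hi, hne⟩
    rw [aux_col hodd z hz i hi] at hne
    have h01 : ∀ a : ZMod 2, a ≠ 0 → a = 1 := by decide
    have hone := h01 _ hne
    have hsub : (Finset.univ.image fun k : Fin d => (k, (⟨d - 1, hlast⟩ : Fin d))) ⊆
        Finset.univ.filter fun p : Fin d × Fin d => z p.1 p.2 = 1 := by
      intro p hp
      simp only [Finset.mem_image, Finset.mem_univ, true_and] at hp
      obtain ⟨k, rfl⟩ := hp
      have := aux_col hodd z hz k k.2
      rw [hone] at this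
      simpa [zext, hlast] using this
    have := Finset.card_le_card hsub
    rw [Finset.card_image_of_injective _ (fun a b hab => (Prod.mk.inj hab).1)] at this
    simpa [wt] using this
  · refine ⟨?_, ?_, ?_, ?_, ?_⟩
    · intro j h1 hj
      rw [aux_zext _ _ _ (by omega) (by omega), aux_zext _ _ _ (by omega) (by omega),
        if_neg (by omega), if_neg (by omega), add_zero]
    · intro j h1 hj
      rw [aux_zext _ _ _ (by omega) (by omega), aux_zext _ _ _ (by omega) (by omega),
        if_neg (by omega), add_zero]
    · intro j h1 hj
      rw [aux_zext _ _ _ (by omega) (by omega), aux_zext _ _ _ (by omega) (by omega),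
        if_pos rfl, h2]
    all_goals
      intro r c hr hr' hc hc'
      intros
      rw [aux_zext _ _ _ (by omega) (by omega), aux_zext _ _ _ (by omega) (by omega),
        aux_zext _ _ _ (by omega) (by omega), aux_zext _ _ _ (by omega) (by omega),
        if_neg (by omega)]
      split_ifs <;> decide
  · have : (Finset.univ.filter fun p : Fin d × Fin d => lastColInd d p.1 p.2 = 1) =
        Finset.univ.image fun k : Fin d => (k, (⟨d - 1, hlast⟩ : Fin d)) := by
      ext ⟨a, b⟩
      simp [lastColInd, Fin.ext_iff, eq_comm]
    rw [wt, this, Finset.card_image_of_injective _ (fun a b hab => (Prod.mk.inj hab).1)]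
    simp
  · intro hmem
    have hz : ∀ f ∈ Submodule.span (ZMod 2) (blockIndicators d),
        f ⟨0, by omega⟩ ⟨d - 1, hlast⟩ = 0 := by
      intro f hf
      induction hf using Submodule.span_induction with
      | mem x hx =>
        rcases hx with ⟨j, h1, hj, rfl⟩ | ⟨i, j, _, _, h1, hj, rfl⟩
        · exact if_neg (by dsimp only; omega)
        · exact if_neg (by dsimp only; omega)
      | zero => rfl
      | add x y _ _ hx hy => simp [hx, hy]
      | smul a x _ hx => simp [hx]
    have := hz _ hmem
    simp [lastColInd] at this
end

section
/- Let d ≥ 3 be odd. The rotated d×d XY code has exactly d²−1 stabilizers in total, of which exactly 3(d²−1)/4 are fixed in the new state-preparation protocol (namely all X-type stabilizers together with the top boundary pairs and the four-body faces with r even and c odd). That is, three-fourths of the stabilizers can be used to detect phase errors in the first measurement round. -/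
/-- The support of the four-body face stabilizer with 1-based top-left corner
`(r,c)`, i.e. `{(r,c),(r,c+1),(r+1,c),(r+1,c+1)}` (shifted to 0-based). -/
def face (d r c : ℕ) : Finset (Fin d × Fin d) :=
  Finset.univ.filter fun p =>
    (p.1.val = r - 1 ∨ p.1.val = r) ∧ (p.2.val = c - 1 ∨ p.2.val = c)

/-- Top boundary pair `{(1,2j−1),(1,2j)}` (Y-type). -/
def topPair (d j : ℕ) : Finset (Fin d × Fin d) :=
  Finset.univ.filter fun p =>
    p.1.val = 0 ∧ (p.2.val = 2 * j - 2 ∨ p.2.val = 2 * j - 1)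

/-- Bottom boundary pair `{(d,2j),(d,2j+1)}` (Y-type). -/
def botPair (d j : ℕ) : Finset (Fin d × Fin d) :=
  Finset.univ.filter fun p =>
    p.1.val = d - 1 ∧ (p.2.val = 2 * j - 1 ∨ p.2.val = 2 * j)

/-- Left boundary pair `{(2i,1),(2i+1,1)}` (X-type). -/
def leftPair (d i : ℕ) : Finset (Fin d × Fin d) :=
  Finset.univ.filter fun p =>
    (p.1.val = 2 * i - 1 ∨ p.1.val = 2 * i) ∧ p.2.val = 0

/-- Right boundary pair `{(2i−1,d),(2i,d)}` (X-type). -/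
def rightPair (d i : ℕ) : Finset (Fin d × Fin d) :=
  Finset.univ.filter fun p =>
    (p.1.val = 2 * i - 2 ∨ p.1.val = 2 * i - 1) ∧ p.2.val = d - 1

/-- All stabilizers of the rotated `d × d` XY code: the `(d−1)²` four-body
faces together with all top, bottom, left and right boundary pairs. -/
def allStabs (d : ℕ) : Finset (Finset (Fin d × Fin d)) :=
  (((Finset.Icc 1 (d - 1)) ×ˢ (Finset.Icc 1 (d - 1))).image
      fun rc => face d rc.1 rc.2) ∪
  ((Finset.Icc 1 ((d - 1) / 2)).image (topPair d)) ∪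
  ((Finset.Icc 1 ((d - 1) / 2)).image (botPair d)) ∪
  ((Finset.Icc 1 ((d - 1) / 2)).image (leftPair d)) ∪
  ((Finset.Icc 1 ((d - 1) / 2)).image (rightPair d))

/-- The stabilizers fixed in the new state-preparation protocol: all X-type
stabilizers (faces with `r + c` even, left and right boundary pairs), the top
boundary pairs, and the faces with `r` even and `c` odd. -/
def fixedStabs (d : ℕ) : Finset (Finset (Fin d × Fin d)) :=
  ((((Finset.Icc 1 (d - 1)) ×ˢ (Finset.Icc 1 (d - 1))).filter
      fun rc => (rc.1 + rc.2) % 2 = 0).image fun rc => face d rc.1 rc.2) ∪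
  ((Finset.Icc 1 ((d - 1) / 2)).image (leftPair d)) ∪
  ((Finset.Icc 1 ((d - 1) / 2)).image (rightPair d)) ∪
  ((Finset.Icc 1 ((d - 1) / 2)).image (topPair d)) ∪
  ((((Finset.Icc 1 (d - 1)) ×ˢ (Finset.Icc 1 (d - 1))).filter
      fun rc => rc.1 % 2 = 0 ∧ rc.2 % 2 = 1).image fun rc => face d rc.1 rc.2)

open Finset in
theorem aux_mem (d r c x y : ℕ) (hx : x < d) (hy : y < d) :
    ((⟨x, hx⟩, ⟨y, hy⟩) : Fin d × Fin d) ∈ face d r c ↔ (x = r - 1 ∨ x = r) ∧ (y = c - 1 ∨ y = c) := by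
  simp [face]

theorem aux_sub (d r c r' c' : ℕ) (hd : 3 ≤ d) (hr : r ≤ d) (hc : c ≤ d)
    (h : face d r c = face d r' c') (x y : ℕ) (hx : x < d) (hy : y < d)
    (h1 : x = r - 1 ∨ x = r) (h2 : y = c - 1 ∨ y = c) :
    (x = r' - 1 ∨ x = r') ∧ (y = c' - 1 ∨ y = c') := by
  rw [← aux_mem d r' c' x y hx hy, ← h, aux_mem]
  exact ⟨h1, h2⟩

theorem aux_inj (d r c r' c' : ℕ) (hd : 3 ≤ d) (hr : r ≤ d) (hc : c ≤ d) (hr' : r' ≤ d)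
    (hc' : c' ≤ d) (h : face d r c = face d r' c') : r = r' ∧ c = c' := by
  have A := aux_sub d r c r' c' hd hr hc h
  have B := aux_sub d r' c' r c hd hr' hc' h.symm
  have A0 := A (r - 1) (c - 1) (by omega) (by omega) (by omega) (by omega)
  have B0 := B (r' - 1) (c' - 1) (by omega) (by omega) (by omega) (by omega)
  have A1 := fun hx => A r (c - 1) hx (by omega) (by omega) (by omega)
  have B1 := fun hx => B r' (c' - 1) hx (by omega) (by omega) (by omega)
  have A2 := fun hy => A (r - 1) c (by omega) hy (by omega) (by omega)
  have B2 := fun hy => B (r' - 1) c' (by omega) hy (by omega) (by omega)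
  clear A B h
  constructor
  · clear A2 B2
    by_cases h1 : r < d
    · have := A1 h1
      by_cases h2 : r' < d
      · have := B1 h2; omega
      · omega
    · by_cases h2 : r' < d
      · have := B1 h2; omega
      · omega
  · clear A1 B1
    by_cases h1 : c < d
    · have := A2 h1
      by_cases h2 : c' < d
      · have := B2 h2; omega
      · omega
    · by_cases h2 : c' < d
      · have := B2 h2; omega
      · omega

theorem aux_top (d j : ℕ) : topPair d j = face d 0 (2 * j - 1) := by
  ext p; simp only [topPair, face, Finset.mem_filter, Finset.mem_univ, true_and]; omega

theorem aux_bot (d j : ℕ) : botPair d j = face d d (2 * j) := by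
  ext p; have := p.1.2
  simp only [botPair, face, Finset.mem_filter, Finset.mem_univ, true_and]; omega

theorem aux_left (d j : ℕ) : leftPair d j = face d (2 * j) 0 := by
  ext p; simp only [leftPair, face, Finset.mem_filter, Finset.mem_univ, true_and]; omega

theorem aux_right (d j : ℕ) : rightPair d j = face d (2 * j - 1) d := by
  ext p; have := p.2.2
  simp only [rightPair, face, Finset.mem_filter, Finset.mem_univ, true_and]; omega

/-- Index set of all stabilizers. -/
def idxAll (m : ℕ) : Finset (ℕ × ℕ) :=
  ((Finset.Icc 1 (2 * m)) ×ˢ (Finset.Icc 1 (2 * m))) ∪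
  ((Finset.Icc 1 m).image fun j => (0, 2 * j - 1)) ∪
  ((Finset.Icc 1 m).image fun j => (2 * m + 1, 2 * j)) ∪
  ((Finset.Icc 1 m).image fun j => (2 * j, 0)) ∪
  ((Finset.Icc 1 m).image fun j => (2 * j - 1, 2 * m + 1))

/-- Index set of the fixed stabilizers. -/
def idxFix (m : ℕ) : Finset (ℕ × ℕ) :=
  (((Finset.Icc 1 (2 * m)) ×ˢ (Finset.Icc 1 (2 * m))).filter fun rc => (rc.1 + rc.2) % 2 = 0) ∪
  ((Finset.Icc 1 m).image fun j => (2 * j, 0)) ∪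
  ((Finset.Icc 1 m).image fun j => (2 * j - 1, 2 * m + 1)) ∪
  ((Finset.Icc 1 m).image fun j => (0, 2 * j - 1)) ∪
  (((Finset.Icc 1 (2 * m)) ×ˢ (Finset.Icc 1 (2 * m))).filter
    fun rc => rc.1 % 2 = 0 ∧ rc.2 % 2 = 1)

theorem aux_all (m : ℕ) : allStabs (2 * m + 1) =
    (idxAll m).image fun rc => face (2 * m + 1) rc.1 rc.2 := by
  have e : 2 * m / 2 = m := by omega
  simp only [allStabs, idxAll, Finset.image_union, Finset.image_image, Nat.add_sub_cancel, e,
    Function.comp_def, aux_top, aux_bot, aux_left, aux_right,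
    funext (aux_top _), funext (aux_bot _), funext (aux_left _), funext (aux_right _)]

theorem aux_fix (m : ℕ) : fixedStabs (2 * m + 1) =
    (idxFix m).image fun rc => face (2 * m + 1) rc.1 rc.2 := by
  have e : 2 * m / 2 = m := by omega
  simp only [fixedStabs, idxFix, Finset.image_union, Finset.image_image, Nat.add_sub_cancel, e,
    Function.comp_def,
    funext (aux_top _), funext (aux_left _), funext (aux_right _)]

theorem idx_sub (m : ℕ) : idxFix m ⊆ idxAll m := by
  intro x hx
  simp only [idxFix, idxAll, Finset.mem_union, Finset.mem_filter] at hx ⊢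
  tauto

theorem idxAll_le (m : ℕ) (x : ℕ × ℕ) (hx : x ∈ idxAll m) : x.1 ≤ 2 * m + 1 ∧ x.2 ≤ 2 * m + 1 := by
  obtain ⟨a, b⟩ := x
  simp only [idxAll, Finset.mem_union, Finset.mem_product, Finset.mem_image, Finset.mem_Icc,
    Prod.mk.injEq] at hx
  rcases hx with (((h | ⟨j, h⟩) | ⟨j, h⟩) | ⟨j, h⟩) | ⟨j, h⟩ <;> constructor <;> dsimp only <;> omega

theorem card_img (m : ℕ) (f : ℕ → ℕ × ℕ)
    (hf : ∀ i j, 1 ≤ i → 1 ≤ j → f i = f j → i = j) : ((Finset.Icc 1 m).image f).card = m := by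
  rw [Finset.card_image_of_injOn]
  · simp
  · intro i hi j hj h
    simp only [Finset.coe_Icc, Set.mem_Icc] at hi hj
    exact hf i j hi.1 hj.1 h

theorem idxAll_card (m : ℕ) : (idxAll m).card = 4 * m ^ 2 + 4 * m := by
  unfold idxAll
  rw [Finset.card_union_of_disjoint, Finset.card_union_of_disjoint, Finset.card_union_of_disjoint,
    Finset.card_union_of_disjoint, card_img, card_img, card_img, card_img]
  · simp; ring
  all_goals first
    | (intro i j hi hj h; simp only [Prod.mk.injEq] at h; omega)
    | (rw [Finset.disjoint_left]
       rintro ⟨a, b⟩ hx hy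
       simp only [Finset.mem_union, Finset.mem_product, Finset.mem_image, Finset.mem_Icc,
         Prod.mk.injEq] at hx hy
       grind)

theorem card_ev (m : ℕ) : ((Finset.Icc 1 (2 * m)).filter fun a => a % 2 = 0).card = m := by
  have : ((Finset.Icc 1 (2 * m)).filter fun a => a % 2 = 0) =
      (Finset.Icc 1 m).image fun j => 2 * j := by
    ext a
    simp only [Finset.mem_filter, Finset.mem_image, Finset.mem_Icc]
    exact ⟨fun h => ⟨a / 2, by omega, by omega⟩, fun ⟨j, h⟩ => by omega⟩
  rw [this, Finset.card_image_of_injective _ (fun a b h => by simpa using h)]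
  simp

theorem card_od (m : ℕ) : ((Finset.Icc 1 (2 * m)).filter fun a => a % 2 = 1).card = m := by
  have h := Finset.card_filter_add_card_filter_not (s := Finset.Icc 1 (2 * m)) (fun a => a % 2 = 0)
  rw [card_ev] at h
  simp at h
  omega

theorem idxFix_card (m : ℕ) : (idxFix m).card = 3 * m ^ 2 + 3 * m := by
  have e1 : (((Finset.Icc 1 (2 * m)) ×ˢ (Finset.Icc 1 (2 * m))).filter
      fun rc => (rc.1 + rc.2) % 2 = 0) =
      ((Finset.Icc 1 (2 * m)).filter fun a => a % 2 = 0) ×ˢ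
        ((Finset.Icc 1 (2 * m)).filter fun a => a % 2 = 0) ∪
      ((Finset.Icc 1 (2 * m)).filter fun a => a % 2 = 1) ×ˢ
        ((Finset.Icc 1 (2 * m)).filter fun a => a % 2 = 1) := by
    ext ⟨a, b⟩
    simp only [Finset.mem_union, Finset.mem_product, Finset.mem_filter, Finset.mem_Icc]
    omega
  have e2 : (((Finset.Icc 1 (2 * m)) ×ˢ (Finset.Icc 1 (2 * m))).filter
      fun rc => rc.1 % 2 = 0 ∧ rc.2 % 2 = 1) =
      ((Finset.Icc 1 (2 * m)).filter fun a => a % 2 = 0) ×ˢ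
        ((Finset.Icc 1 (2 * m)).filter fun a => a % 2 = 1) := by
    ext ⟨a, b⟩
    simp only [Finset.mem_product, Finset.mem_filter, Finset.mem_Icc]
    omega
  unfold idxFix
  rw [e1, e2]
  rw [Finset.card_union_of_disjoint, Finset.card_union_of_disjoint, Finset.card_union_of_disjoint,
    Finset.card_union_of_disjoint, Finset.card_union_of_disjoint, card_img, card_img, card_img]
  · simp only [Finset.card_product, card_ev, card_od]; ring
  all_goals first
    | (intro i j hi hj h; simp only [Prod.mk.injEq] at h; omega)
    | (rw [Finset.disjoint_left]
       rintro ⟨a, b⟩ hx hy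
       simp only [Finset.mem_union, Finset.mem_product, Finset.mem_image, Finset.mem_Icc,
         Finset.mem_filter, Prod.mk.injEq] at hx hy
       grind)

/-- The rotated `d × d` XY code has exactly `d² − 1` stabilizers, of which
exactly `3(d² − 1)/4` are fixed in the new state-preparation protocol: i.e.
three-fourths of the stabilizers can be used to detect phase errors in the
first measurement round. -/
theorem stabilizer_count (d : ℕ) (hd : 3 ≤ d) (hodd : d % 2 = 1) :
    fixedStabs d ⊆ allStabs d ∧
    (allStabs d).card = d ^ 2 - 1 ∧
    (fixedStabs d).card = 3 * (d ^ 2 - 1) / 4 ∧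
    4 * (fixedStabs d).card = 3 * (allStabs d).card := by
  obtain ⟨m, rfl⟩ : ∃ m, d = 2 * m + 1 := ⟨d / 2, by omega⟩
  have inj : Set.InjOn (fun rc : ℕ × ℕ => face (2 * m + 1) rc.1 rc.2) (idxAll m : Set (ℕ × ℕ)) := by
    intro x hx y hy h
    have a := idxAll_le m x hx
    have b := idxAll_le m y hy
    have := aux_inj _ _ _ _ _ hd a.1 a.2 b.1 b.2 h
    exact Prod.ext this.1 this.2
  have c1 : (allStabs (2 * m + 1)).card = 4 * m ^ 2 + 4 * m := by
    rw [aux_all, Finset.card_image_of_injOn inj, idxAll_card]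
  have c2 : (fixedStabs (2 * m + 1)).card = 3 * m ^ 2 + 3 * m := by
    rw [aux_fix, Finset.card_image_of_injOn (inj.mono (by exact_mod_cast idx_sub m)), idxFix_card]
  have e : (2 * m + 1) ^ 2 = 4 * m ^ 2 + 4 * m + 1 := by ring
  refine ⟨?_, ?_, ?_, ?_⟩
  · rw [aux_all, aux_fix]
    exact Finset.image_subset_image (idx_sub m)
  · rw [c1, e]; omega
  · rw [c2, e]; omega
  · rw [c1, c2]; ring
end

section
/- Let d ≥ 3 be odd and let s : {1,…,d}×{1,…,d} → 𝔽₂. Suppose s has even overlap with the support of every stabilizer of the rotated d×d XY code, i.e., the sum of s over each four-body face and over each boundary pair is 0 in 𝔽₂. Then s is identically 0 or identically 1. (Hence the only nontrivial Z-type logical operator of the XY code is Z applied to every qubit, the code reduces to a length-n repetition code under pure Z noise, and its distance to pure Z errors is n = d².) -/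
/-- If `s` has even overlap with the support of every stabilizer of the
rotated `d × d` XY code — every four-body face `{(r,c),(r,c+1),(r+1,c),
(r+1,c+1)}`, every top pair `{(1,2j−1),(1,2j)}`, bottom pair `{(d,2j),(d,2j+1)}`,
left pair `{(2i,1),(2i+1,1)}` and right pair `{(2i−1,d),(2i,d)}` — then `s` is
identically `0` or identically `1`.  Hence the only nontrivial Z-type logical
operator is `Z` on every qubit, and the XY code reduces to a length-`n = d²`
repetition code under pure `Z` noise. (1-based indices shifted to 0-based.) -/
theorem Z_logical_is_all_ones (d : ℕ) (hd : 3 ≤ d) (hodd : d % 2 = 1)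
    (s : Fin d → Fin d → ZMod 2)
    (hface : ∀ r c, 1 ≤ r → r ≤ d - 1 → 1 ≤ c → c ≤ d - 1 →
      zext s (r - 1) (c - 1) + zext s (r - 1) c
        + zext s r (c - 1) + zext s r c = 0)
    (htop : ∀ j, 1 ≤ j → j ≤ (d - 1) / 2 →
      zext s 0 (2 * j - 2) + zext s 0 (2 * j - 1) = 0)
    (hbot : ∀ j, 1 ≤ j → j ≤ (d - 1) / 2 →
      zext s (d - 1) (2 * j - 1) + zext s (d - 1) (2 * j) = 0)
    (hleft : ∀ i, 1 ≤ i → i ≤ (d - 1) / 2 →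
      zext s (2 * i - 1) 0 + zext s (2 * i) 0 = 0)
    (hright : ∀ i, 1 ≤ i → i ≤ (d - 1) / 2 →
      zext s (2 * i - 2) (d - 1) + zext s (2 * i - 1) (d - 1) = 0) :
    (∀ i j, s i j = 0) ∨ (∀ i j, s i j = 1) := by
  have key : ∀ a b c e : ZMod 2, a + b + c + e = 0 → a + b = c + e := by decide
  have key2 : ∀ a b c e : ZMod 2, a + b + c + e = 0 → a + c = b + e := by decide
  have eq0 : ∀ a b : ZMod 2, a + b = 0 → a = b := by decide
  have H : ∀ r c, r + 1 < d → c + 1 < d → zext s r c + zext s r (c+1)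
      + zext s (r+1) c + zext s (r+1) (c+1) = 0 := by
    intro r c hr hc
    exact hface (r+1) (c+1) (by omega) (by omega) (by omega) (by omega)
  have R : ∀ c, c + 1 < d → ∀ r, r < d →
      zext s r c + zext s r (c+1) = zext s 0 c + zext s 0 (c+1) := by
    intro c hc r
    induction r with
    | zero => intro _; rfl
    | succ r ih =>
      intro hr
      rw [← ih (by omega)]
      exact (key _ _ _ _ (H r c hr hc)).symm
  have C : ∀ r, r + 1 < d → ∀ c, c < d →
      zext s r c + zext s (r+1) c = zext s r 0 + zext s (r+1) 0 := by
    intro r hr c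
    induction c with
    | zero => intro _; rfl
    | succ c ih =>
      intro hc
      rw [← ih (by omega)]
      exact (key2 _ _ _ _ (H r c hr hc)).symm
  have R0 : ∀ c, c + 1 < d → zext s 0 c = zext s 0 (c+1) := by
    intro c hc
    apply eq0
    rcases Nat.even_or_odd' c with ⟨k, rfl | rfl⟩
    · exact htop (k+1) (by omega) (by omega)
    · rw [← R _ hc (d-1) (by omega)]
      exact hbot (k+1) (by omega) (by omega)
  have C0 : ∀ r, r + 1 < d → zext s r 0 = zext s (r+1) 0 := by
    intro r hr
    apply eq0
    rcases Nat.even_or_odd' r with ⟨k, rfl | rfl⟩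
    · rw [← C _ hr (d-1) (by omega)]
      exact hright (k+1) (by omega) (by omega)
    · exact hleft (k+1) (by omega) (by omega)
  have A : ∀ r, r < d → zext s r 0 = zext s 0 0 := by
    intro r
    induction r with
    | zero => intro _; rfl
    | succ r ih => intro hr; rw [← C0 r hr]; exact ih (by omega)
  have B : ∀ r, r < d → ∀ c, c < d → zext s r c = zext s 0 0 := by
    intro r hr c
    induction c with
    | zero => intro _; exact A r hr
    | succ c ih =>
      intro hc
      rw [← ih (by omega)]
      symm
      apply eq0
      rw [R c hc r hr, R0 c hc]
      exact CharTwo.add_self_eq_zero _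
  have S : ∀ i j, s i j = zext s 0 0 := by
    intro i j
    rw [← B i i.2 j j.2]
    simp [zext]
  have dich : ∀ a : ZMod 2, a = 0 ∨ a = 1 := by decide
  rcases dich (zext s 0 0) with h | h
  · left; intro i j; rw [S, h]
  · right; intro i j; rw [S, h]
end
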